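/- Let W be a standard Brownian motion on a probability space (Ω, F, P). For every real T with T ≥ π/(2√2), E[exp(∫_0^T W_t² dt)] = ∞, i.e. the random variable ω ↦ exp(∫_0^T W_t(ω)² dt) is not integrable (its Lebesgue integral with values in [0,∞] equals ∞). -/

import Mathlib

open MeasureTheory ProbabilityTheory Real

/-- A standard Brownian motion: a jointly measurable real process with a.s. continuous
paths on `[0, ∞)`, starting at `0`, whose finite-dimensional distributions are centered
Gaussian with covariance `E[W_s W_t] = min s t` (expressed via the Cramér–Wold device:
every finite linear combination `∑ i, c i * W (t i)` is a centered Gaussian random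
variable with the corresponding variance `∑ i, ∑ j, c i * c j * min (t i) (t j)`). -/
structure IsStandardBrownianMotion {Ω : Type*} [MeasureSpace Ω] (W : ℝ → Ω → ℝ) : Prop where
  jointly_measurable : Measurable fun p : ℝ × Ω => W p.1 p.2
  ae_continuous : ∀ᵐ ω : Ω, ContinuousOn (fun t => W t ω) (Set.Ici (0 : ℝ))
  start_at_zero : ∀ᵐ ω : Ω, W 0 ω = 0
  gaussian_fdd : ∀ (k : ℕ) (t : Fin k → ℝ), (∀ i, 0 ≤ t i) → ∀ c : Fin k → ℝ,
    Measure.map (fun ω => ∑ i, c i * W (t i) ω) (ℙ : Measure Ω)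
      = gaussianReal 0 (∑ i, ∑ j, c i * c j * min (t i) (t j)).toNNReal

open Filter Topology

theorem tendsto_riemann_sum {T : ℝ} (hT : 0 < T) {f : ℝ → ℝ}
    (hf : ContinuousOn f (Set.Icc 0 T)) :
    Tendsto (fun n : ℕ => T / n * ∑ j : Fin n, f (T / n * j)) atTop
      (𝓝 (∫ t in (0 : ℝ)..T, f t)) := by
  rw [Metric.tendsto_atTop]
  intro ε hε
  have huc := isCompact_Icc.uniformContinuousOn_of_continuous hf
  rw [Metric.uniformContinuousOn_iff] at huc
  obtain ⟨δ, hδ, hδf⟩ := huc (ε / (2 * T)) (by positivity)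
  obtain ⟨N, hN⟩ := exists_nat_gt (T / δ)
  refine ⟨N + 1, fun n hn => ?_⟩
  have hn0 : (0 : ℝ) < n := by exact_mod_cast (by omega : 0 < n)
  have hNn : (N : ℝ) ≤ n := by exact_mod_cast (by omega : N ≤ n)
  set h : ℝ := T / n with hh
  have hpos : 0 < h := by positivity
  have hhδ : h < δ := by
    rw [hh, div_lt_iff₀ hn0]
    rw [div_lt_iff₀ hδ] at hN
    nlinarith
  have hnh : h * n = T := by rw [hh]; field_simp
  have hmem : ∀ j < n, ∀ t ∈ Set.Icc (h * j) (h * (j + 1 : ℕ)), t ∈ Set.Icc 0 T := by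
    intro j hj t ht
    have h1 : ((j + 1 : ℕ) : ℝ) ≤ n := by exact_mod_cast hj
    refine ⟨le_trans (by positivity) ht.1, ht.2.trans ?_⟩
    rw [← hnh]
    gcongr
  have hstep : ∀ j : ℕ, h * j ≤ h * (j + 1 : ℕ) := fun j => by gcongr; simp
  have hint : ∀ j < n, IntervalIntegrable f volume (h * j) (h * (j + 1 : ℕ)) := by
    intro j hj
    refine ContinuousOn.intervalIntegrable ?_
    rw [Set.uIcc_of_le (hstep j)]
    exact hf.mono (hmem j hj)
  have hsum := intervalIntegral.sum_integral_adjacent_intervals (a := fun j : ℕ => h * j) hint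
  simp only [Nat.cast_zero, mul_zero, hnh] at hsum
  rw [dist_eq_norm, ← hsum, Fin.sum_univ_eq_sum_range (fun j => f (h * j)), Finset.mul_sum,
    ← Finset.sum_sub_distrib]
  have hbd : ∀ j ∈ Finset.range n,
      ‖h * f (h * j) - ∫ t in h * j..h * (j + 1 : ℕ), f t‖ ≤ ε / (2 * T) * h := by
    intro j hj
    have hj' := Finset.mem_range.1 hj
    have hlen : h * (j + 1 : ℕ) - h * j = h := by push_cast; ring
    have : h * f (h * j) - ∫ t in h * j..h * (j + 1 : ℕ), f t
        = ∫ t in h * j..h * (j + 1 : ℕ), (f (h * j) - f t) := by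
      rw [intervalIntegral.integral_sub (by simp) (hint j hj'),
        intervalIntegral.integral_const, hlen, smul_eq_mul]
    rw [this]
    refine (intervalIntegral.norm_integral_le_of_norm_le_const (C := ε / (2 * T)) ?_).trans ?_
    · intro t ht
      rw [Set.uIoc_of_le (hstep j)] at ht
      have ht' : t ∈ Set.Icc (h * j) (h * (j + 1 : ℕ)) := Set.Ioc_subset_Icc_self ht
      rw [← dist_eq_norm]
      refine (hδf _ (hmem j hj' _ ⟨le_rfl, hstep j⟩) _ (hmem j hj' _ ht') ?_).le
      rw [Real.dist_eq, abs_sub_comm, abs_of_nonneg (by linarith [ht'.1])]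
      linarith [ht'.2]
    · rw [hlen, abs_of_pos hpos]
  calc _ ≤ ∑ j ∈ Finset.range n, ε / (2 * T) * h := norm_sum_le_of_le _ hbd
    _ = ε / 2 := by
      rw [Finset.sum_const, Finset.card_range, nsmul_eq_mul, hh]
      field_simp
    _ < ε := by linarith

theorem sum_min_mul_sin (θ : ℝ) (i m : ℕ) (him : i ≤ m) :
    (2 - 2 * cos θ) * ∑ j ∈ Finset.range m, min (i : ℝ) j * sin (j * θ)
      = sin (i * θ) + i * (sin ((m - 1) * θ) - sin (m * θ)) := by
  have hrec (j : ℝ) : (2 - 2 * cos θ) * sin (j * θ)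
      = 2 * sin (j * θ) - sin ((j - 1) * θ) - sin ((j + 1) * θ) := by
    rw [sub_mul j, add_mul j, one_mul, sin_sub, sin_add]; ring
  have hbase (i : ℕ) : (2 - 2 * cos θ) * ∑ j ∈ Finset.range i, (j : ℝ) * sin (j * θ)
      = i * sin ((i - 1) * θ) - (i - 1) * sin (i * θ) := by
    induction i with
    | zero => simp
    | succ k ih =>
      rw [Finset.sum_range_succ, mul_add, ih, mul_left_comm, hrec]
      push_cast
      ring_nf
  induction m, him using Nat.le_induction with
  | base =>
    rw [Finset.sum_congr rfl fun j hj => by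
      rw [min_eq_right (by exact_mod_cast (Finset.mem_range.1 hj).le)], hbase]
    ring
  | succ k hk ih =>
    rw [Finset.sum_range_succ, mul_add, ih, min_eq_left (by exact_mod_cast hk),
      mul_left_comm, hrec]
    push_cast
    ring_nf

theorem sum_sum_sin_mul_min {n : ℕ} (hn : n ≠ 0) :
    (2 - 2 * cos (π / (2 * n))) * ∑ i : Fin n, ∑ j : Fin n,
        sin (i * (π / (2 * n))) * sin (j * (π / (2 * n))) * min (i : ℝ) j
      = ∑ i : Fin n, sin (i * (π / (2 * n))) ^ 2
        - (1 - cos (π / (2 * n))) * ∑ i : Fin n, i * sin (i * (π / (2 * n))) := by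
  have hn' : (n : ℝ) ≠ 0 := by exact_mod_cast hn
  set θ := π / (2 * n) with hθ
  have h1 : (n : ℝ) * θ = π / 2 := by rw [hθ]; field_simp
  have h2 : sin (((n : ℝ) - 1) * θ) = cos θ := by
    rw [sub_mul, h1, one_mul, sin_pi_div_two_sub]
  rw [Finset.mul_sum, Finset.mul_sum, ← Finset.sum_sub_distrib]
  refine Finset.sum_congr rfl fun i _ => ?_
  have h3 := sum_min_mul_sin θ i n i.2.le
  rw [h1, h2, sin_pi_div_two, ← Fin.sum_univ_eq_sum_range (fun j => min (i : ℝ) j * sin (j * θ))] at h3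
  calc _ = sin (i * θ) * ((2 - 2 * cos θ) * ∑ j : Fin n, min (i : ℝ) j * sin (j * θ)) := by
        simp only [Finset.mul_sum]
        exact Finset.sum_congr rfl fun j _ => by ring
    _ = _ := by rw [h3]; ring

theorem lintegral_exp_sq_gaussianReal {a : ℝ} {v : NNReal} (hav : 1 ≤ 2 * v * a) :
    ∫⁻ x, ENNReal.ofReal (exp (a * x ^ 2)) ∂gaussianReal 0 v = ⊤ := by
  have hv : v ≠ 0 := by rintro rfl; norm_num at hav
  have hv' : (0 : ℝ) < v := by positivity
  rw [gaussianReal_of_var_ne_zero _ hv,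
    lintegral_withDensity_eq_lintegral_mul _ (measurable_gaussianPDF 0 v) (by fun_prop),
    eq_top_iff]
  calc (⊤ : ENNReal) = ∫⁻ _ : ℝ, ENNReal.ofReal (√(2 * π * v))⁻¹ := by
        rw [lintegral_const, Real.volume_univ, ENNReal.mul_top]
        simp only [ne_eq, ENNReal.ofReal_eq_zero, not_le]
        positivity
    _ ≤ _ := by
        refine lintegral_mono fun x => ?_
        simp only [Pi.mul_apply, gaussianPDF, gaussianPDFReal, sub_zero]
        rw [← ENNReal.ofReal_mul (by positivity), mul_assoc _ (exp _), ← exp_add]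
        refine ENNReal.ofReal_le_ofReal (le_mul_of_one_le_right (by positivity) (one_le_exp ?_))
        have : -x ^ 2 / (2 * v) + a * x ^ 2 = x ^ 2 * (2 * v * a - 1) / (2 * v) := by
          field_simp; ring
        rw [this]
        have : 0 ≤ 2 * v * a - 1 := by linarith
        positivity

theorem map_eq_gaussianReal_of_tendsto {Ω : Type*} [MeasurableSpace Ω] {P : Measure Ω}
    [IsProbabilityMeasure P] {X : ℕ → Ω → ℝ} {Z : Ω → ℝ} {u : ℕ → NNReal} {v : NNReal}
    (hX : ∀ n, AEMeasurable (X n) P) (hZ : AEMeasurable Z P)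
    (hlaw : ∀ n, P.map (X n) = gaussianReal 0 (u n))
    (hlim : ∀ᵐ ω ∂P, Tendsto (fun n => X n ω) atTop (𝓝 (Z ω)))
    (hu : Tendsto u atTop (𝓝 v)) :
    P.map Z = gaussianReal 0 v := by
  have := Measure.isProbabilityMeasure_map hZ
  refine Measure.ext_of_charFun (funext fun s => ?_)
  have hchar {Y : Ω → ℝ} (hY : AEMeasurable Y P) :
      charFun (P.map Y) s = ∫ ω, Complex.exp (s * Y ω * Complex.I) ∂P := by
    rw [charFun_apply_real, integral_map hY (by fun_prop)]
  have h1 : Tendsto (fun n => charFun (P.map (X n)) s) atTop (𝓝 (charFun (P.map Z) s)) := by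
    simp only [hchar hZ, fun n => hchar (hX n)]
    refine tendsto_integral_of_dominated_convergence (fun _ => 1) (fun n => ?_)
      (integrable_const _) (fun n => .of_forall fun ω => ?_) ?_
    · have := hX n
      exact AEMeasurable.aestronglyMeasurable (by fun_prop)
    · rw [← Complex.ofReal_mul, Complex.norm_exp_ofReal_mul_I]
    · filter_upwards [hlim] with ω hω
      have hc : Continuous fun x : ℝ => Complex.exp (s * x * Complex.I) := by fun_prop
      exact (hc.tendsto _).comp hω
  have h2 : Tendsto (fun n => charFun (P.map (X n)) s) atTop (𝓝 (charFun (gaussianReal 0 v) s)) := by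
    simp only [hlaw, charFun_gaussianReal]
    have hc : Continuous fun x : NNReal =>
        Complex.exp (s * (0 : ℝ) * Complex.I - ((x : ℝ) : ℂ) * s ^ 2 / 2) := by fun_prop
    exact (hc.tendsto v).comp hu
  exact tendsto_nhds_unique h1 h2

theorem integral_sin_sq_quarter_period {T : ℝ} (hT : 0 < T) :
    ∫ t in (0 : ℝ)..T, sin (π / (2 * T) * t) ^ 2 = T / 2 := by
  have hc : π / (2 * T) ≠ 0 := by positivity
  rw [intervalIntegral.integral_comp_mul_left (fun x => sin x ^ 2) hc, integral_sin_sq,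
    show π / (2 * T) * T = π / 2 by field_simp]
  simp
  field_simp

theorem tendsto_sum_sum_sin_mul_min {T : ℝ} (hT : 0 < T) :
    Tendsto (fun n : ℕ => ∑ i : Fin n, ∑ j : Fin n,
        (T / n * sin (π / (2 * T) * (T / n * i))) * (T / n * sin (π / (2 * T) * (T / n * j)))
          * min (T / n * i) (T / n * j)) atTop
      (𝓝 (2 * T ^ 3 / π ^ 2)) := by
  have hsq := integral_sin_sq_quarter_period hT
  have hQ := tendsto_riemann_sum hT (f := fun t => sin (π / (2 * T) * t) ^ 2) (by fun_prop)
  have hR := tendsto_riemann_sum hT (f := fun t => t * sin (π / (2 * T) * t)) (by fun_prop)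
  have hh : Tendsto (fun n : ℕ => T / (n : ℝ)) atTop (𝓝 0) := tendsto_const_div_atTop_nhds_zero_nat T
  have hs : Tendsto (fun n : ℕ => 4 * T ^ 2 / π ^ 2 / sinc (π / 4 / n) ^ 2) atTop
      (𝓝 (4 * T ^ 2 / π ^ 2)) := by
    have h1 := (continuous_sinc.tendsto 0).comp (tendsto_const_div_atTop_nhds_zero_nat (π / 4))
    rw [sinc_zero] at h1
    simpa [Function.comp_def, Pi.div_def] using
      (tendsto_const_nhds (x := 4 * T ^ 2 / π ^ 2)).div (h1.pow 2) (by norm_num)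
  have hmain := (hs.mul hQ).sub ((hh.mul hR).div_const 2)
  rw [hsq] at hmain
  have hval : 4 * T ^ 2 / π ^ 2 * (T / 2)
      - 0 * (∫ t in (0 : ℝ)..T, t * sin (π / (2 * T) * t)) / 2 = 2 * T ^ 3 / π ^ 2 := by ring
  rw [hval] at hmain
  refine hmain.congr' ?_
  filter_upwards [eventually_ge_atTop 1] with n hn
  have hn0 : (0 : ℝ) < n := by exact_mod_cast hn
  have harg (i : ℝ) : π / (2 * T) * (T / n * i) = i * (π / (2 * n)) := by
    field_simp
  have hmin (i j : ℝ) : min (T / n * i) (T / n * j) = T / n * min i j :=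
    (mul_min_of_nonneg _ _ (by positivity)).symm
  have hx : 0 < π / 4 / n := by positivity
  have hxπ : π / 4 / n < π := by
    have : (1 : ℝ) ≤ n := by exact_mod_cast hn
    rw [div_div, div_lt_iff₀ (by positivity)]
    nlinarith [pi_pos]
  have hsin : 0 < sin (π / 4 / n) := sin_pos_of_pos_of_lt_pi hx hxπ
  have hcos : cos (π / (2 * n)) = 1 - 2 * sin (π / 4 / n) ^ 2 := by
    rw [show π / (2 * n) = 2 * (π / 4 / n) by field_simp; norm_num, cos_two_mul, cos_sq']
    ring
  have hS := sum_sum_sin_mul_min (n := n) (by omega)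
  simp only [harg, hmin]
  have hfac : ∑ i : Fin n, ∑ j : Fin n, (T / n * sin (i * (π / (2 * n))))
        * (T / n * sin (j * (π / (2 * n)))) * (T / n * min (i : ℝ) j)
      = (T / n) ^ 3 * ∑ i : Fin n, ∑ j : Fin n,
        sin (i * (π / (2 * n))) * sin (j * (π / (2 * n))) * min (i : ℝ) j := by
    simp only [Finset.mul_sum]
    exact Finset.sum_congr rfl fun i _ => Finset.sum_congr rfl fun j _ => by ring
  have hfacR : ∑ i : Fin n, T / n * i * sin (i * (π / (2 * n)))
      = T / n * ∑ i : Fin n, i * sin (i * (π / (2 * n))) := by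
    simp only [Finset.mul_sum]
    exact Finset.sum_congr rfl fun i _ => by ring
  rw [hfac, hfacR, sinc_of_ne_zero hx.ne']
  generalize ∑ i : Fin n, ∑ j : Fin n,
    sin (i * (π / (2 * n))) * sin (j * (π / (2 * n))) * min (i : ℝ) j = S at *
  generalize ∑ i : Fin n, sin (i * (π / (2 * n))) ^ 2 = Q at *
  generalize ∑ i : Fin n, (i : ℝ) * sin (i * (π / (2 * n))) = R at *
  rw [hcos] at hS
  generalize sin (π / 4 / n) = s at *
  have hQS : Q = 4 * s ^ 2 * S + 2 * s ^ 2 * R := by linarith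
  rw [hQS]
  field_simp
  ring

theorem sq_integral_mul_sin_le {T : ℝ} (hT : 0 < T) {f : ℝ → ℝ}
    (hf : ContinuousOn f (Set.Icc 0 T)) :
    2 / T * (∫ t in (0 : ℝ)..T, sin (π / (2 * T) * t) * f t) ^ 2 ≤ ∫ t in (0 : ℝ)..T, f t ^ 2 := by
  set Z := ∫ t in (0 : ℝ)..T, sin (π / (2 * T) * t) * f t with hZ
  have hint {g : ℝ → ℝ} (hg : ContinuousOn g (Set.Icc 0 T)) : IntervalIntegrable g volume 0 T :=
    ContinuousOn.intervalIntegrable (by rwa [Set.uIcc_of_le hT.le])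
  have h0 : 0 ≤ ∫ t in (0 : ℝ)..T, (f t - 2 / T * Z * sin (π / (2 * T) * t)) ^ 2 :=
    intervalIntegral.integral_nonneg hT.le fun t _ => sq_nonneg _
  have h1 (k : ℝ) : ∫ t in (0 : ℝ)..T, (f t - k * sin (π / (2 * T) * t)) ^ 2
      = (∫ t in (0 : ℝ)..T, f t ^ 2) - 2 * k * Z + k ^ 2 * (T / 2) := by
    rw [hZ, ← integral_sin_sq_quarter_period hT, ← intervalIntegral.integral_const_mul (2 * k),
      ← intervalIntegral.integral_const_mul (k ^ 2),
      ← intervalIntegral.integral_sub (hint (by fun_prop)) (hint (by fun_prop)),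
      ← intervalIntegral.integral_add (hint (by fun_prop)) (hint (by fun_prop))]
    exact intervalIntegral.integral_congr fun t _ => by ring
  rw [h1] at h0
  have h2 : (2 / T * Z) ^ 2 * (T / 2) = 2 / T * Z ^ 2 := by field_simp
  have h3 : 2 * (2 / T * Z) * Z = 2 * (2 / T * Z ^ 2) := by ring
  linarith

theorem exp_integral_brownian_sq_infinite {Ω : Type*} [MeasureSpace Ω]
    [IsProbabilityMeasure (ℙ : Measure Ω)] (W : ℝ → Ω → ℝ)
    (hW : IsStandardBrownianMotion W) (T : ℝ)
    (hT : π / (2 * Real.sqrt 2) ≤ T) :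
    ∫⁻ ω, ENNReal.ofReal (Real.exp (∫ t in (0 : ℝ)..T, (W t ω) ^ 2)) ∂(ℙ : Measure Ω)
      = ⊤ := by
  have hT0 : 0 < T := lt_of_lt_of_le (by positivity) hT
  have hjm := hW.jointly_measurable
  have hWm (t : ℝ) : Measurable (W t) := hjm.comp measurable_prodMk_left
  set Z : Ω → ℝ := fun ω => ∫ t in (0 : ℝ)..T, sin (π / (2 * T) * t) * W t ω with hZ
  have hZm : Measurable Z := by
    have h : StronglyMeasurable fun p : Ω × ℝ => sin (π / (2 * T) * p.2) * W p.2 p.1 := by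
      refine Measurable.stronglyMeasurable ?_
      have h' : Measurable fun p : Ω × ℝ => W p.2 p.1 := hjm.comp measurable_swap
      fun_prop
    simp only [hZ, intervalIntegral.integral_of_le hT0.le]
    exact h.integral_prod_right.measurable
  have hcont : ∀ᵐ ω : Ω, ContinuousOn (fun t => W t ω) (Set.Icc 0 T) := by
    filter_upwards [hW.ae_continuous] with ω hω using hω.mono Set.Icc_subset_Ici_self
  have hlaw : Measure.map Z ℙ = gaussianReal 0 (2 * T ^ 3 / π ^ 2).toNNReal := by
    refine map_eq_gaussianReal_of_tendsto
      (X := fun n ω => ∑ j : Fin n, T / n * sin (π / (2 * T) * (T / n * j)) * W (T / n * j) ω)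
      (fun n => ?_) hZm.aemeasurable
      (fun n => hW.gaussian_fdd n (fun j => T / n * j) (fun j => by positivity)
        (fun j => T / n * sin (π / (2 * T) * (T / n * j)))) ?_
      ((continuous_real_toNNReal.tendsto _).comp (tendsto_sum_sum_sin_mul_min hT0))
    · fun_prop
    · filter_upwards [hcont] with ω hω
      simpa only [Finset.mul_sum, mul_assoc] using tendsto_riemann_sum hT0
        (f := fun t => sin (π / (2 * T) * t) * W t ω) (by fun_prop)
  have hvar : 1 ≤ 2 * ((2 * T ^ 3 / π ^ 2).toNNReal : ℝ) * (2 / T) := by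
    rw [Real.coe_toNNReal _ (by positivity)]
    rw [div_le_iff₀ (by positivity)] at hT
    have h1 : π ^ 2 ≤ (T * (2 * √2)) ^ 2 := by gcongr
    have h2 : (T * (2 * √2)) ^ 2 = 8 * T ^ 2 := by
      rw [mul_pow, mul_pow, sq_sqrt (by norm_num)]; ring
    have h3 : 2 * (2 * T ^ 3 / π ^ 2) * (2 / T) = 8 * T ^ 2 / π ^ 2 := by field_simp; norm_num
    rw [h3, le_div_iff₀ (by positivity)]
    linarith
  rw [eq_top_iff, ← lintegral_exp_sq_gaussianReal hvar, ← hlaw,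
    lintegral_map (by fun_prop) hZm]
  refine lintegral_mono_ae ?_
  filter_upwards [hcont] with ω hω
  exact ENNReal.ofReal_le_ofReal (exp_le_exp.2 (sq_integral_mul_sin_le hT0 hω))
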